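/- arXiv:1408.2464 — 3 statements merged into one kernel-verified Lean document; each statement's English description precedes it below -/
import Mathlib

section
/- Let ι be a nonempty finite index set. For each i ∈ ι let n_i ∈ ℕ, let S_i ⊆ ℝ^{n_i} be a nonempty, compact, convex set, and let Ψ_i : (∏_{j∈ι} ℝ^{n_j}) → ℝ be a continuous function such that for every i ∈ ι and every fixed profile s with s_j ∈ S_j for all j, the map x ↦ Ψ_i(s with its i-th coordinate replaced by x) is concave on S_i. Then a pure Nash equilibrium exists: there is a profile s* with s*_j ∈ S_j for all j such that for every i ∈ ι and every x ∈ S_i, Ψ_i(s* with its i-th coordinate replaced by x) ≤ Ψ_i(s*). -/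
open Matrix

section Scarf

variable {I X α : Type*} [LinearOrder α]

/-- A finite set `P` is dominant for the family of rankings `r` if no point beats all of `P`
strictly in every ranking. -/
def IsDominant (r : I → X → α) (P : Finset X) : Prop :=
  ∀ y, ∃ i, ∀ p ∈ P, r i y ≤ r i p

theorem IsDominant.mono {r : I → X → α} {P Q : Finset X} (h : IsDominant r P) (hQ : Q ⊆ P) :
    IsDominant r Q := fun y =>
  let ⟨i, hi⟩ := h y
  ⟨i, fun p hp => hi p (hQ hp)⟩

theorem exists_argmin (r : I → X → α) {P : Finset X} (hP : P.Nonempty) :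
    ∃ a : I → X, (∀ i, a i ∈ P) ∧ ∀ i, ∀ p ∈ P, r i (a i) ≤ r i p := by
  choose a ha using fun i => P.exists_min_image (r i) hP
  exact ⟨a, fun i => (ha i).1, fun i => (ha i).2⟩

theorem IsDominant.exists_argmin_eq {r : I → X → α} (hr : ∀ i, Function.Injective (r i))
    {P : Finset X} (h : IsDominant r P) {a : I → X} (haP : ∀ i, a i ∈ P)
    (ha : ∀ i, ∀ p ∈ P, r i (a i) ≤ r i p) {p : X} (hp : p ∈ P) : ∃ i, a i = p := by
  obtain ⟨i, hi⟩ := h p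
  exact ⟨i, hr i (le_antisymm (ha i p hp) (hi _ (haP i)))⟩

variable [Fintype I] [DecidableEq I]

/-- A surjection onto a set with one element less identifies exactly one pair. -/
theorem exists_collision {τ : Finset X} (hcard : τ.card + 1 = Fintype.card I) {a : I → X}
    (haτ : ∀ i, a i ∈ τ) (hsurj : ∀ p ∈ τ, ∃ i, a i = p) :
    ∃ i j, i ≠ j ∧ a i = a j ∧
      ∀ l, l = i ∨ l = j → ∀ p ∈ τ, ∃ k, k ≠ l ∧ a k = p := by
  obtain ⟨i, -, j, -, hij, haij⟩ := Finset.exists_ne_map_eq_of_card_lt_of_maps_to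
    (s := Finset.univ) (t := τ) (f := a) (by rw [Finset.card_univ]; omega) (by simpa using haτ)
  refine ⟨i, j, hij, haij, ?_⟩
  rintro l hl p hp
  obtain ⟨k, rfl⟩ := hsurj p hp
  by_cases hk : k = l
  · subst hk
    rcases hl with rfl | rfl
    · exact ⟨j, hij.symm, haij.symm⟩
    · exact ⟨i, hij, haij⟩
  · exact ⟨k, hk, rfl⟩

variable [DecidableEq X]

theorem isDominant_insert_iff {r : I → X → α} (hr : ∀ i, Function.Injective (r i))
    {τ : Finset X} (hτ : IsDominant r τ) (hcard : τ.card + 1 = Fintype.card I) {a : I → X}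
    (haτ : ∀ i, a i ∈ τ) (ha : ∀ i, ∀ p ∈ τ, r i (a i) ≤ r i p) {i j : I} (hij : i ≠ j)
    (haij : a i = a j) (hsurj : ∀ l, l = i ∨ l = j → ∀ p ∈ τ, ∃ k, k ≠ l ∧ a k = p) (x : X) :
    (x ∉ τ ∧ IsDominant r (insert x τ)) ↔ ∃ l, (l = i ∨ l = j) ∧
      (∀ k, k ≠ l → r k (a k) < r k x) ∧
      ∀ y, (∀ k, k ≠ l → r k (a k) < r k y) → r l y ≤ r l x := by
  constructor
  · rintro ⟨hx, hd⟩
    obtain ⟨b, hb, hbmin⟩ := exists_argmin r (Finset.insert_nonempty x τ)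
    have hbs := fun p hp => hd.exists_argmin_eq hr hb hbmin (p := p) hp
    have hinj : Function.Injective b := by
      have himg : Finset.univ.image b = insert x τ := by
        ext p
        simp only [Finset.mem_image, Finset.mem_univ, true_and]
        exact ⟨fun ⟨k, hk⟩ => hk ▸ hb k, hbs p⟩
      have hbcard : (Finset.univ.image b).card = (Finset.univ : Finset I).card := by
        rw [himg, Finset.card_insert_of_notMem hx, hcard, Finset.card_univ]
      exact fun k l hkl => Finset.card_image_iff.mp hbcard (by simp) (by simp) hkl
    obtain ⟨l, hl⟩ := hbs x (Finset.mem_insert_self x τ)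
    have hlt : ∀ k, k ≠ l → b k = a k ∧ r k (a k) < r k x := by
      intro k hk
      have hkx : b k ≠ x := fun h => hk (hinj (h.trans hl.symm))
      have hkτ : b k ∈ τ := (Finset.mem_insert.mp (hb k)).resolve_left hkx
      have : b k = a k := hr k (le_antisymm (hbmin k _ (Finset.mem_insert_of_mem (haτ k)))
        (ha k _ hkτ))
      refine ⟨this, lt_of_le_of_ne ?_ ?_⟩
      · rw [← this]; exact hbmin k x (Finset.mem_insert_self x τ)
      · rw [← this]; exact fun h => hkx (hr k h)
    refine ⟨l, ?_, fun k hk => (hlt k hk).2, fun y hy => ?_⟩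
    · by_contra! hne
      exact hij (hinj (by rw [(hlt i hne.1.symm).1, (hlt j hne.2.symm).1, haij]))
    · obtain ⟨k, hk⟩ := hd y
      by_cases hkl : k = l
      · subst hkl
        exact hk x (Finset.mem_insert_self x τ)
      · exact absurd (hk (a k) (Finset.mem_insert_of_mem (haτ k))) (not_le.mpr (hy k hkl))
  · rintro ⟨l, hl, hx, hmax⟩
    have hlx : ∀ p ∈ τ, r l x ≤ r l p := by
      obtain ⟨k, hk⟩ := hτ x
      by_cases hkl : k = l
      · subst hkl
        exact hk
      · exact absurd (hk (a k) (haτ k)) (not_le.mpr (hx k hkl))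
    refine ⟨fun hxτ => ?_, fun y => ?_⟩
    · obtain ⟨k, hkl, rfl⟩ := hsurj l hl x hxτ
      exact lt_irrefl _ (hx k hkl)
    · by_cases hy : ∀ k, k ≠ l → r k (a k) < r k y
      · refine ⟨l, fun p hp => ?_⟩
        rcases Finset.mem_insert.mp hp with rfl | hp
        · exact hmax y hy
        · exact (hmax y hy).trans (hlx p hp)
      · push Not at hy
        obtain ⟨k, hkl, hk⟩ := hy
        refine ⟨k, fun p hp => ?_⟩
        rcases Finset.mem_insert.mp hp with rfl | hp
        · exact hk.trans (hx k hkl).le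
        · exact hk.trans (ha k p hp)

theorem isDominant_image_slack {r : I → X → α} {s : I → X}
    (hmin : ∀ i x, r i (s i) ≤ r i x)
    (hmax : ∀ i j x, j ≠ i → x ∉ Set.range s → r i x < r i (s j)) (i₀ : I) :
    IsDominant r ((Finset.univ.erase i₀).image s) := by
  intro y
  by_cases hy : y ∈ Set.range s
  · obtain ⟨k, rfl⟩ := hy
    exact ⟨k, fun p _ => hmin k p⟩
  · refine ⟨i₀, fun p hp => ?_⟩
    obtain ⟨k, hk, rfl⟩ := Finset.mem_image.mp hp
    exact (hmax i₀ k y (Finset.ne_of_mem_erase hk) hy).le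

/-- A set of full size that is not rainbow has an even number of facets missing only `i₀`. -/
theorem even_card_facets {c : X → I} {P : Finset X} (hP : P.card = Fintype.card I)
    (hc : P.image c ≠ Finset.univ) (i₀ : I) :
    Even (P.filter fun q => (P.erase q).image c = Finset.univ.erase i₀).card := by
  rcases (P.filter fun q => (P.erase q).image c = Finset.univ.erase i₀).eq_empty_or_nonempty
    with h | ⟨q, hq⟩
  · simp [h]
  obtain ⟨hqP, hq⟩ := Finset.mem_filter.mp hq
  have hcard : ((P.erase q).image c).card = (P.erase q).card := by
    rw [hq, Finset.card_erase_of_mem hqP, hP, Finset.card_erase_of_mem (Finset.mem_univ _),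
      Finset.card_univ]
  have hinj := Finset.card_image_iff.mp hcard
  have hqi : c q ≠ i₀ := by
    intro h
    apply hc
    rw [← Finset.insert_erase hqP, Finset.image_insert, hq, h,
      Finset.insert_erase (Finset.mem_univ _)]
  have hmem : c q ∈ (P.erase q).image c := by rw [hq]; simpa using hqi
  obtain ⟨q', hq', hqq'⟩ := Finset.mem_image.mp hmem
  have hne : q ≠ q' := (Finset.ne_of_mem_erase hq').symm
  have hq'P := Finset.mem_of_mem_erase hq'
  have : (P.filter fun q => (P.erase q).image c = Finset.univ.erase i₀) = {q, q'} := by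
    ext x
    rw [Finset.mem_filter, Finset.mem_insert, Finset.mem_singleton]
    constructor
    · rintro ⟨hxP, hx⟩
      by_contra! hxne
      have hxc : c x ∈ (P.erase x).image c := by
        rw [hx, ← hq]
        exact Finset.mem_image_of_mem c (by simp [hxne.1, hxP])
      have hcard' : ((P.erase x).image c).card = (P.erase x).card := by
        rw [hx, Finset.card_erase_of_mem hxP, hP, Finset.card_erase_of_mem (Finset.mem_univ _),
          Finset.card_univ]
      exact hne (Finset.card_image_iff.mp hcard' (by simp [hqP, hxne.1.symm])
        (by simp [hq'P, hxne.2.symm]) hqq'.symm)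
    · rintro (rfl | rfl)
      · exact ⟨hqP, hq⟩
      · refine ⟨hq'P, ?_⟩
        rw [← hq]
        ext k
        simp only [Finset.mem_image, Finset.mem_erase]
        constructor
        · rintro ⟨y, ⟨hy1, hy2⟩, rfl⟩
          by_cases hyq : y = q
          · exact ⟨x, ⟨hne.symm, hq'P⟩, by rw [hyq, hqq']⟩
          · exact ⟨y, ⟨hyq, hy2⟩, rfl⟩
        · rintro ⟨y, ⟨hy1, hy2⟩, rfl⟩
          by_cases hyq : y = x
          · exact ⟨q, ⟨hne, hqP⟩, by rw [hyq, hqq']⟩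
          · exact ⟨y, ⟨hyq, hy2⟩, rfl⟩
  rw [this, Finset.card_pair hne]
  exact even_two

variable [Fintype X]

open Classical in
/-- A dominant set with one element less than the number of rankings, containing a point that is
not a slack point, has exactly two dominant one-point extensions. -/
theorem card_dominant_insert_eq_two {r : I → X → α} (hr : ∀ i, Function.Injective (r i))
    {s : I → X} (hmax : ∀ i j x, j ≠ i → x ∉ Set.range s → r i x < r i (s j))
    {τ : Finset X} (hτ : IsDominant r τ) (hcard : τ.card + 1 = Fintype.card I)
    {t : X} (ht : t ∈ τ) (hts : t ∉ Set.range s) :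
    (Finset.univ.filter fun x => x ∉ τ ∧ IsDominant r (insert x τ)).card = 2 := by
  obtain ⟨a, haτ, ha⟩ := exists_argmin r ⟨t, ht⟩
  obtain ⟨i, j, hij, haij, hsurj⟩ := exists_collision hcard haτ
    (fun p hp => hτ.exists_argmin_eq hr haτ ha hp)
  have hiff := isDominant_insert_iff hr hτ hcard haτ ha hij haij hsurj
  have hex : ∀ l, ∃ x, (∀ k, k ≠ l → r k (a k) < r k x) ∧
      ∀ y, (∀ k, k ≠ l → r k (a k) < r k y) → r l y ≤ r l x := by
    intro l
    obtain ⟨x, hx, hxm⟩ := (Finset.univ.filter fun x => ∀ k, k ≠ l → r k (a k) < r k x)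
      |>.exists_max_image (r l) ⟨s l, by
        simpa using fun k hk => (ha k t ht).trans_lt (hmax k l t (Ne.symm hk) hts)⟩
    exact ⟨x, by simpa using hx, fun y hy => hxm y (by simpa using hy)⟩
  choose e he hem using hex
  have huniq : ∀ l x, (∀ k, k ≠ l → r k (a k) < r k x) →
      (∀ y, (∀ k, k ≠ l → r k (a k) < r k y) → r l y ≤ r l x) → x = e l := fun l x h1 h2 =>
    hr l (le_antisymm (hem l x h1) (h2 _ (he l)))
  have hne : e i ≠ e j := by
    intro h
    obtain ⟨k, hk⟩ := hτ (e i)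
    by_cases hki : k = i
    · subst hki
      exact absurd (hk _ (haτ k)) (not_le.mpr (h ▸ he j k hij))
    · exact absurd (hk _ (haτ k)) (not_le.mpr (he i k hki))
  rw [Finset.card_eq_two]
  refine ⟨e i, e j, hne, ?_⟩
  ext x
  rw [Finset.mem_filter, hiff x]
  simp only [Finset.mem_univ, true_and, Finset.mem_insert, Finset.mem_singleton]
  constructor
  · rintro ⟨l, rfl | rfl, h1, h2⟩
    · exact Or.inl (huniq _ _ h1 h2)
    · exact Or.inr (huniq _ _ h1 h2)
  · rintro (rfl | rfl)
    · exact ⟨i, Or.inl rfl, he i, hem i⟩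
    · exact ⟨j, Or.inr rfl, he j, hem j⟩

open Classical in
/-- The facet spanned by all slack points but one has exactly one dominant one-point extension. -/
theorem card_dominant_insert_slack_eq_one {r : I → X → α} (hr : ∀ i, Function.Injective (r i))
    {s : I → X} (hmin : ∀ i x, r i (s i) ≤ r i x)
    (hmax : ∀ i j x, j ≠ i → x ∉ Set.range s → r i x < r i (s j))
    (hs : ∃ x, x ∉ Set.range s) (i₀ : I) :
    (Finset.univ.filter fun x => x ∉ (Finset.univ.erase i₀).image s ∧
      IsDominant r (insert x ((Finset.univ.erase i₀).image s))).card = 1 := by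
  obtain ⟨t, ht⟩ := hs
  obtain ⟨m, hm, hmm⟩ := (Finset.univ.filter fun x => x ∉ Set.range s).exists_max_image (r i₀)
    ⟨t, by simpa using ht⟩
  have hm' : m ∉ Set.range s := (Finset.mem_filter.mp hm).2
  rw [Finset.card_eq_one]
  refine ⟨m, ?_⟩
  ext x
  rw [Finset.mem_filter, Finset.mem_singleton]
  constructor
  · rintro ⟨-, hx, hd⟩
    have hk : ∀ y, y ∉ Set.range s → ∀ k, (∀ p ∈ insert x ((Finset.univ.erase i₀).image s),
        r k y ≤ r k p) → k = i₀ := by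
      intro y hy k hk
      by_contra hne
      have := hk (s k) (Finset.mem_insert_of_mem (Finset.mem_image_of_mem s (by simpa using hne)))
      exact hy ⟨k, hr k (le_antisymm (hmin k y) this)⟩
    have hxs : x ∉ Set.range s := by
      rintro ⟨k, rfl⟩
      have hki : k = i₀ := by
        by_contra hne
        exact hx (Finset.mem_image_of_mem s (by simpa using hne))
      subst hki
      obtain ⟨l, hl⟩ := hd t
      obtain rfl := hk t ht l hl
      exact ht ⟨l, hr l (le_antisymm (hmin l t) (hl _ (Finset.mem_insert_self _ _)))⟩
    obtain ⟨l, hl⟩ := hd m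
    obtain rfl := hk m hm' l hl
    exact hr l (le_antisymm (hmm x (by simpa using hxs)) (hl x (Finset.mem_insert_self _ _)))
  · rintro rfl
    refine ⟨Finset.mem_univ _, fun h => ?_, fun y => ?_⟩
    · obtain ⟨k, -, hk⟩ := Finset.mem_image.mp h
      exact hm' ⟨k, hk⟩
    · by_cases hy : y ∈ Set.range s
      · obtain ⟨k, rfl⟩ := hy
        exact ⟨k, fun p _ => hmin k p⟩
      · refine ⟨i₀, fun p hp => ?_⟩
        rcases Finset.mem_insert.mp hp with rfl | hp
        · exact hmm y (by simpa using hy)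
        · obtain ⟨k, hk, rfl⟩ := Finset.mem_image.mp hp
          exact (hmax i₀ k y (Finset.ne_of_mem_erase hk) hy).le

/-- **Scarf's lemma**: a colouring of finitely many ranked points, compatible with the slack
points, admits a dominant set on which every colour occurs. -/
theorem exists_rainbow_dominant [Nonempty I] {r : I → X → α}
    (hr : ∀ i, Function.Injective (r i))
    {s : I → X} (hmin : ∀ i x, r i (s i) ≤ r i x)
    (hmax : ∀ i j x, j ≠ i → x ∉ Set.range s → r i x < r i (s j))
    (hs : ∃ x, x ∉ Set.range s) {c : X → I} (hcs : ∀ i, c (s i) = i) :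
    ∃ P : Finset X, IsDominant r P ∧ P.image c = Finset.univ := by
  classical
  by_contra! hno
  obtain ⟨i₀⟩ := ‹Nonempty I›
  let D : Finset (Finset X) := Finset.univ.filter fun τ =>
    IsDominant r τ ∧ τ.card + 1 = Fintype.card I ∧ τ.image c = Finset.univ.erase i₀
  let R : Finset (Finset X) := Finset.univ.filter fun P =>
    IsDominant r P ∧ P.card = Fintype.card I
  let up : Finset X → Finset X := fun τ =>
    Finset.univ.filter fun x => x ∉ τ ∧ IsDominant r (insert x τ)
  let down : Finset X → Finset X := fun P =>
    P.filter fun q => (P.erase q).image c = Finset.univ.erase i₀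
  have hcount : ∑ τ ∈ D, (up τ).card = ∑ P ∈ R, (down P).card := by
    rw [← Finset.card_sigma, ← Finset.card_sigma]
    refine Finset.card_bij' (fun z _ => ⟨insert z.2 z.1, z.2⟩) (fun z _ => ⟨z.1.erase z.2, z.2⟩)
      ?_ ?_ ?_ ?_
    · rintro ⟨τ, x⟩ h
      simp only [Finset.mem_sigma, D, R, up, down, Finset.mem_filter, Finset.mem_univ,
        true_and] at h ⊢
      obtain ⟨⟨-, h2, h3⟩, h4, h5⟩ := h
      exact ⟨⟨h5, by rw [Finset.card_insert_of_notMem h4, h2]⟩, Finset.mem_insert_self _ _,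
        by rw [Finset.erase_insert h4, h3]⟩
    · rintro ⟨P, q⟩ h
      simp only [Finset.mem_sigma, D, R, up, down, Finset.mem_filter, Finset.mem_univ,
        true_and] at h ⊢
      obtain ⟨⟨h1, h2⟩, h3, h4⟩ := h
      exact ⟨⟨h1.mono (Finset.erase_subset _ _), by rw [Finset.card_erase_add_one h3, h2], h4⟩,
        Finset.notMem_erase _ _, by rwa [Finset.insert_erase h3]⟩
    · rintro ⟨τ, x⟩ h
      simp only [Finset.mem_sigma, up, Finset.mem_filter] at h
      simp [Finset.erase_insert h.2.2.1]
    · rintro ⟨P, q⟩ h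
      simp only [Finset.mem_sigma, down, Finset.mem_filter] at h
      simp [Finset.insert_erase h.2.1]
  have heven : Even (∑ P ∈ R, (down P).card) := by
    refine Finset.even_sum _ fun P hP => ?_
    obtain ⟨h1, h2⟩ := (Finset.mem_filter.mp hP).2
    exact even_card_facets h2 (hno P h1) i₀
  let τ₀ : Finset X := (Finset.univ.erase i₀).image s
  have hτ₀ : τ₀ ∈ D := by
    refine Finset.mem_filter.mpr ⟨Finset.mem_univ _, isDominant_image_slack hmin hmax i₀, ?_, ?_⟩
    · rw [Finset.card_image_of_injective _ (Function.LeftInverse.injective hcs),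
        Finset.card_erase_add_one (Finset.mem_univ _), Finset.card_univ]
    · simp [τ₀, Finset.image_image, Function.comp_def, hcs]
  have hrest : Even (∑ τ ∈ D.erase τ₀, (up τ).card) := by
    refine Finset.even_sum _ fun τ hτ => ?_
    obtain ⟨hne, hτD⟩ := Finset.mem_erase.mp hτ
    obtain ⟨h1, h2, h3⟩ := (Finset.mem_filter.mp hτD).2
    have : ∃ t ∈ τ, t ∉ Set.range s := by
      by_contra! hall
      apply hne
      simp only [τ₀]
      rw [← h3, Finset.image_image]
      refine (Finset.image_congr (g := id) fun t ht => ?_).trans Finset.image_id |>.symm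
      obtain ⟨k, rfl⟩ := hall t ht
      simp [hcs]
    obtain ⟨t, ht, hts⟩ := this
    exact (card_dominant_insert_eq_two hr hmax h1 h2 ht hts) ▸ even_two
  rw [← hcount, ← Finset.add_sum_erase _ _ hτ₀,
    show (up τ₀).card = 1 from card_dominant_insert_slack_eq_one hr hmin hmax hs i₀] at heven
  exact absurd heven (by simpa [Nat.even_add] using hrest)

end Scarf

section Brouwer

variable {I : Type*} [Fintype I]

/-- Any colouring of the lattice points of a dilated simplex admits a small cluster of lattice
points in which every colour occurs, except colours whose coordinate is small on the cluster. -/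
theorem exists_rainbow_cluster [Nonempty I] (N : ℕ) (c : (I → ℕ) → I) :
    ∃ Q : Finset (I → ℕ), Q.Nonempty ∧ (∀ x ∈ Q, ∑ i, x i = N) ∧
      (∀ x ∈ Q, ∀ y ∈ Q, ∀ i, x i ≤ y i + Fintype.card I) ∧
      ∀ i, (∃ x ∈ Q, c x = i) ∨ ∀ x ∈ Q, x i ≤ Fintype.card I := by
  classical
  let T := {x : I → ℕ // x ∈ Finset.piAntidiag Finset.univ N}
  let _ : Fintype T := FinsetCoe.fintype (Finset.piAntidiag Finset.univ N)
  have hT : ∀ x : T, ∑ i, x.1 i = N := fun x => (Finset.mem_piAntidiag.mp x.2).1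
  let key : I → T ⊕ I → ℤ := fun i =>
    Sum.elim (fun x => (x.1 i : ℤ)) (fun j => if j = i then -1 else N + 1)
  let e := Fintype.equivFin (T ⊕ I)
  let r : I → T ⊕ I → ℤ ×ₗ Fin (Fintype.card (T ⊕ I)) := fun i z => toLex (key i z, e z)
  have hlt : ∀ i z w, key i z < key i w → r i z < r i w := fun i z w h =>
    Prod.Lex.toLex_lt_toLex.mpr (Or.inl h)
  have hle : ∀ i z w, r i z ≤ r i w → key i z ≤ key i w := fun i z w h =>
    not_lt.mp fun h' => absurd h (not_le.mpr (hlt i w z h'))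
  have hr : ∀ i, Function.Injective (r i) := fun i z w h =>
    e.injective (congrArg (fun q => (ofLex q).2) h)
  have hmin : ∀ i z, r i (Sum.inr i) ≤ r i z := by
    rintro i (x | j)
    · exact (hlt _ _ _ (by simp [key]; omega)).le
    · by_cases hj : j = i
      · rw [hj]
      · exact (hlt _ _ _ (by simp [key, hj])).le
  have hmax : ∀ i j z, j ≠ i → z ∉ Set.range (Sum.inr : I → T ⊕ I) →
      r i z < r i (Sum.inr j) := by
    rintro i j (x | k) hj hz
    · refine hlt _ _ _ ?_
      have : x.1 i ≤ ∑ j, x.1 j := Finset.single_le_sum (fun _ _ => Nat.zero_le _)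
        (Finset.mem_univ i)
      rw [hT x] at this
      simp [key, hj]
      omega
    · exact absurd ⟨k, rfl⟩ hz
  obtain ⟨i₀⟩ := ‹Nonempty I›
  have hsingle : Pi.single i₀ N ∈ Finset.piAntidiag (Finset.univ : Finset I) N := by
    simp [Finset.mem_piAntidiag]
  obtain ⟨P, hP, hPc⟩ := exists_rainbow_dominant (I := I) hr (s := Sum.inr) hmin hmax
    ⟨Sum.inl ⟨_, hsingle⟩, by simp⟩ (c := Sum.elim (fun x => c x.1) id) (fun i => rfl)
  have hcol : ∀ i, Sum.inr i ∉ P → ∃ x : T, Sum.inl x ∈ P ∧ c x.1 = i := by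
    intro i hi
    obtain ⟨z, hz, hzi⟩ := Finset.mem_image.mp (hPc ▸ Finset.mem_univ i)
    rcases z with x | j
    · exact ⟨x, hz, hzi⟩
    · exact absurd ((show j = i from hzi) ▸ hz) hi
  have hdom : ∀ y : T, ∃ i, Sum.inr i ∉ P ∧ ∀ x : T, Sum.inl x ∈ P → y.1 i ≤ x.1 i := by
    intro y
    obtain ⟨i, hi⟩ := hP (Sum.inl y)
    refine ⟨i, fun h => ?_, fun x hx => ?_⟩
    · have := hle _ _ _ (hi _ h)
      simp [key] at this
      omega
    · have := hle _ _ _ (hi _ hx)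
      simpa [key] using this
  obtain ⟨k, hk, -⟩ := hdom ⟨_, hsingle⟩
  let Q : Finset (I → ℕ) := (P.preimage Sum.inl Sum.inl_injective.injOn).image Subtype.val
  have hQ : ∀ x, x ∈ Q ↔ ∃ t : T, Sum.inl t ∈ P ∧ t.1 = x := fun x => by
    simp only [Q, Finset.mem_image, Finset.mem_preimage]
    exact Iff.rfl
  have hQne : Q.Nonempty := by
    obtain ⟨x, hx, -⟩ := hcol k hk
    exact ⟨x.1, (hQ _).mpr ⟨x, hx, rfl⟩⟩
  have hQN : ∀ x ∈ Q, ∑ i, x i = N := by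
    intro x hx
    obtain ⟨t, -, rfl⟩ := (hQ x).mp hx
    exact hT t
  let C : Finset I := Finset.univ.filter fun i => Sum.inr i ∉ P
  let a : I → ℕ := fun i => Q.inf' hQne fun x => x i
  have ha : ∀ x ∈ Q, ∀ i, a i ≤ x i := fun x hx i => Finset.inf'_le (fun x => x i) hx
  have hsum : N < ∑ i ∈ C, (a i + 1) := by
    by_contra! hcon
    obtain ⟨d, hd⟩ := Nat.exists_eq_add_of_le hcon
    let y : I → ℕ := fun i => (if i ∈ C then a i + 1 else 0) + if i = i₀ then d else 0
    have hy : ∑ i, y i = N := by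
      simp only [y, Finset.sum_add_distrib, Finset.sum_ite_eq', Finset.mem_univ, if_true,
        Finset.sum_ite_mem, Finset.univ_inter]
      rw [hd, Finset.sum_add_distrib]
    obtain ⟨i, hi, hiy⟩ := hdom ⟨y, Finset.mem_piAntidiag.mpr ⟨hy, by simp⟩⟩
    have hai : a i + 1 ≤ y i := by
      simp [y, show i ∈ C by simpa [C] using hi]
    have : y i ≤ a i := by
      refine Finset.le_inf' hQne _ fun x hx => ?_
      obtain ⟨t, ht, rfl⟩ := (hQ x).mp hx
      exact hiy t ht
    omega
  have hbound : ∀ x ∈ Q, ∀ i, x i ≤ (if i ∈ C then a i else 0) + Fintype.card I := by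
    intro x hx i
    have h1 : ∑ j ∈ C, (a j + 1) ≤ (∑ j, if j ∈ C then a j else 0) + Fintype.card I := by
      rw [Finset.sum_ite_mem, Finset.univ_inter, Finset.sum_add_distrib]
      simpa using Finset.card_le_univ C
    have h2 : ∀ j, (if j ∈ C then a j else 0) ≤ x j := by
      intro j
      split_ifs
      · exact ha x hx j
      · exact Nat.zero_le _
    have h3 := hQN x hx
    rw [← Finset.add_sum_erase _ _ (Finset.mem_univ i)] at h1 h3
    have h4 := Finset.sum_le_sum fun j (_ : j ∈ Finset.univ.erase i) => h2 j
    omega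
  refine ⟨Q, hQne, hQN, fun x hx y hy i => (hbound x hx i).trans ?_, fun i => ?_⟩
  · have := ha y hy i
    split_ifs <;> omega
  · by_cases hi : Sum.inr i ∈ P
    · right
      intro x hx
      simpa [C, hi] using hbound x hx i
    · left
      obtain ⟨x, hx, hxi⟩ := hcol i hi
      exact ⟨x.1, (hQ _).mpr ⟨x, hx, rfl⟩, hxi⟩

/-- **Brouwer's fixed point theorem** for the standard simplex. -/
theorem exists_fixedPoint_stdSimplex [Nonempty I] {f : (I → ℝ) → I → ℝ}
    (hf : ContinuousOn f (stdSimplex ℝ I))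
    (hmaps : Set.MapsTo f (stdSimplex ℝ I) (stdSimplex ℝ I)) :
    ∃ x ∈ stdSimplex ℝ I, f x = x := by
  classical
  by_contra! hno
  have hK : IsCompact (stdSimplex ℝ I) := isCompact_stdSimplex ℝ I
  let F : (I → ℝ) → ℝ := fun w => Finset.univ.sup' Finset.univ_nonempty fun i => w i - f w i
  have hF : ContinuousOn F (stdSimplex ℝ I) :=
    ContinuousOn.finset_sup'_apply _ fun i _ =>
      (continuous_apply i).continuousOn.sub ((continuous_apply i).comp_continuousOn hf)
  obtain ⟨i₀⟩ := ‹Nonempty I›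
  obtain ⟨w₀, hw₀, hmin⟩ := hK.exists_isMinOn ⟨_, single_mem_stdSimplex ℝ i₀⟩ hF
  have hpos : 0 < F w₀ := by
    by_contra! hle
    refine hno w₀ hw₀ ?_
    have hle' : ∀ i, w₀ i ≤ f w₀ i := fun i =>
      sub_nonpos.mp ((Finset.le_sup' (fun i => w₀ i - f w₀ i) (Finset.mem_univ i)).trans hle)
    have hsum : ∑ i, w₀ i = ∑ i, f w₀ i := hw₀.2.trans (hmaps hw₀).2.symm
    exact funext fun i =>
      ((Finset.sum_eq_sum_iff_of_le fun i _ => hle' i).mp hsum i (Finset.mem_univ i)).symm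
  have hgap : ∀ w ∈ stdSimplex ℝ I, ∃ i, F w₀ ≤ w i - f w i := by
    intro w hw
    obtain ⟨i, -, hi⟩ := Finset.exists_mem_eq_sup' Finset.univ_nonempty fun i => w i - f w i
    exact ⟨i, hi ▸ hmin hw⟩
  set δ := F w₀
  obtain ⟨ε, hε, huc⟩ := Metric.uniformContinuousOn_iff.mp
    (hK.uniformContinuousOn_of_continuous hf) (δ / 2) (half_pos hpos)
  obtain ⟨N, hN⟩ := exists_nat_gt ((Fintype.card I : ℝ) / min ε (δ / 2))
  have hη : 0 < min ε (δ / 2) := lt_min hε (half_pos hpos)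
  have hN0 : (0 : ℝ) < N := lt_of_le_of_lt (by positivity) hN
  have hmesh : (Fintype.card I : ℝ) / N < min ε (δ / 2) := by
    rw [div_lt_iff₀ hη] at hN
    rwa [div_lt_iff₀ hN0, mul_comm]
  let g : (I → ℕ) → I → ℝ := fun x i => x i / N
  have hg : ∀ x : I → ℕ, ∑ i, x i = N → g x ∈ stdSimplex ℝ I := by
    intro x hx
    refine ⟨fun i => by positivity, ?_⟩
    simp only [g]
    rw [← Finset.sum_div, ← Nat.cast_sum, hx, div_self hN0.ne']
  have hcolor : ∀ x : I → ℕ, ∃ i, ∑ i, x i = N → g x i ≤ f (g x) i := by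
    intro x
    by_contra! h
    have hx := (h i₀).1
    have := Finset.sum_lt_sum_of_nonempty (Finset.univ_nonempty (α := I)) fun i _ => (h i).2
    rw [(hg x hx).2, (hmaps (hg x hx)).2] at this
    exact lt_irrefl _ this
  choose c hc using hcolor
  obtain ⟨Q, ⟨w, hw⟩, hQN, hQ, hQc⟩ := exists_rainbow_cluster N c
  have hclose : ∀ x ∈ Q, ∀ y ∈ Q, ∀ i, g x i - g y i ≤ Fintype.card I / N := by
    intro x hx y hy i
    simp only [g]
    rw [← sub_div]
    refine div_le_div_of_nonneg_right ?_ hN0.le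
    have : (x i : ℝ) ≤ y i + Fintype.card I := by exact_mod_cast hQ x hx y hy i
    linarith
  have hwS := hg w (hQN w hw)
  obtain ⟨i, hi⟩ := hgap (g w) hwS
  rcases hQc i with ⟨x, hx, hxi⟩ | hsmall
  · have hxS := hg x (hQN x hx)
    have hdist : dist (g x) (g w) < ε := by
      refine (dist_pi_lt_iff hε).mpr fun j => ?_
      rw [Real.dist_eq, abs_lt]
      have h1 := hclose x hx w hw j
      have h2 := hclose w hw x hx j
      have h3 := hmesh.trans_le (min_le_left _ _)
      constructor <;> linarith
    have hfd := (dist_le_pi_dist (f (g x)) (f (g w)) i).trans_lt (huc _ hxS _ hwS hdist)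
    rw [Real.dist_eq, abs_lt] at hfd
    have h1 : g x i ≤ f (g x) i := hxi ▸ hc x (hQN x hx)
    have h2 := hclose w hw x hx i
    have h3 := hmesh.trans_le (min_le_right _ _)
    linarith [hfd.2]
  · have h1 : g w i ≤ Fintype.card I / N :=
      div_le_div_of_nonneg_right (by exact_mod_cast hsmall w hw) hN0.le
    have h2 := (hmaps hwS).1 i
    have h3 := hmesh.trans_le (min_le_right _ _)
    linarith

end Brouwer

/-- A finite family form of the **Ky Fan minimax inequality**. -/
theorem exists_forall_apply_nonpos_of_fintype {E I : Type*} [AddCommGroup E] [Module ℝ E]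
    [TopologicalSpace E] [ContinuousAdd E] [ContinuousSMul ℝ E] [Fintype I] [Nonempty I]
    {K : Set E} (hcvx : Convex ℝ K) {φ : E → E → ℝ}
    (hcont : ∀ y ∈ K, ContinuousOn (fun s => φ s y) K)
    (hconc : ∀ s ∈ K, ConcaveOn ℝ K (φ s)) (hdiag : ∀ s ∈ K, φ s s ≤ 0)
    (y : I → E) (hy : ∀ k, y k ∈ K) : ∃ s ∈ K, ∀ k, φ s (y k) ≤ 0 := by
  by_contra! hno
  let b : (I → ℝ) → E := fun w => ∑ k, w k • y k
  have hb : Set.MapsTo b (stdSimplex ℝ I) K := fun w hw =>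
    hcvx.sum_mem (fun k _ => hw.1 k) hw.2 fun k _ => hy k
  have hbc : Continuous b := by fun_prop
  let g : I → (I → ℝ) → ℝ := fun k w => max (φ (b w) (y k)) 0
  have hg : ∀ k, ContinuousOn (g k) (stdSimplex ℝ I) := fun k =>
    ((hcont (y k) (hy k)).comp hbc.continuousOn hb).sup continuousOn_const
  have hg0 : ∀ k w, 0 ≤ g k w := fun k w => le_max_right _ _
  have hsum : ∀ w ∈ stdSimplex ℝ I, 0 < ∑ k, g k w := by
    intro w hw
    obtain ⟨k, hk⟩ := hno (b w) (hb hw)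
    exact Finset.sum_pos' (fun k _ => hg0 k w) ⟨k, Finset.mem_univ k, lt_max_of_lt_left hk⟩
  obtain ⟨w, hw, hfix⟩ := exists_fixedPoint_stdSimplex
    (f := fun w k => g k w / ∑ j, g j w)
    (continuousOn_pi.mpr fun k => (hg k).div (continuousOn_finsetSum _ fun j _ => hg j)
      fun w hw => (hsum w hw).ne')
    (fun w hw => ⟨fun k => div_nonneg (hg0 k w) (hsum w hw).le, by
      rw [← Finset.sum_div, div_self (hsum w hw).ne']⟩)
  have hwk : ∀ k, w k = g k w / ∑ j, g j w := fun k => (congrFun hfix k).symm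
  have hjensen := (hconc (b w) (hb hw)).le_map_sum (t := Finset.univ) (w := w) (p := y)
    (fun k _ => hw.1 k) hw.2 fun k _ => hy k
  have hpos : 0 < ∑ k, w k • φ (b w) (y k) := by
    have hterm : ∀ k, 0 < φ (b w) (y k) → 0 < w k • φ (b w) (y k) := fun k hk => by
      have : 0 < w k := by
        rw [hwk k]
        exact div_pos (lt_max_of_lt_left hk) (hsum w hw)
      exact mul_pos this hk
    obtain ⟨k, hk⟩ := hno (b w) (hb hw)
    refine Finset.sum_pos' (fun j _ => ?_) ⟨k, Finset.mem_univ k, hterm k hk⟩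
    by_cases hj : 0 < φ (b w) (y j)
    · exact (hterm j hj).le
    · have : w j = 0 := by
        rw [hwk j, show g j w = 0 from max_eq_right (not_lt.mp hj), zero_div]
      simp [this]
  exact absurd (hpos.trans_le hjensen) (not_lt.mpr (hdiag _ (hb hw)))

/-- The **Ky Fan minimax inequality**. -/
theorem exists_forall_apply_nonpos {E : Type*} [AddCommGroup E] [Module ℝ E]
    [TopologicalSpace E] [ContinuousAdd E] [ContinuousSMul ℝ E]
    {K : Set E} (hne : K.Nonempty) (hK : IsCompact K) (hcvx : Convex ℝ K) {φ : E → E → ℝ}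
    (hcont : ∀ y ∈ K, ContinuousOn (fun s => φ s y) K)
    (hconc : ∀ s ∈ K, ConcaveOn ℝ K (φ s)) (hdiag : ∀ s ∈ K, φ s s ≤ 0) :
    ∃ s ∈ K, ∀ y ∈ K, φ s y ≤ 0 := by
  by_contra! hno
  choose! y hyK hy using hno
  obtain ⟨t, htK, ht⟩ := hK.elim_nhdsWithin_subcover (fun s => {x | 0 < φ x (y s)})
    fun s hs => (hcont (y s) (hyK s hs) s hs).eventually_const_lt (hy s hs)
  obtain ⟨s₀, hs₀⟩ := hne
  have : Nonempty t := by
    obtain ⟨s, hs, -⟩ := Set.mem_iUnion₂.mp (ht hs₀)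
    exact ⟨⟨s, hs⟩⟩
  obtain ⟨s, hs, hle⟩ := exists_forall_apply_nonpos_of_fintype hcvx hcont hconc hdiag
    (fun k : t => y k) fun k => hyK k (htK k k.2)
  obtain ⟨k, hk, hpos⟩ := Set.mem_iUnion₂.mp (ht hs)
  exact absurd hpos (not_lt.mpr (hle ⟨k, hk⟩))

/-- Debreu–Glicksberg–Fan: existence of a pure Nash equilibrium for a finite
strategic form game with nonempty compact convex strategy sets and payoffs
that are continuous and concave in each player's own strategy. -/
theorem exists_pure_nash_equilibrium
    {ι : Type*} [Fintype ι] [Nonempty ι] [DecidableEq ι]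
    (n : ι → ℕ) (S : ∀ i, Set (Fin (n i) → ℝ))
    (hne : ∀ i, (S i).Nonempty)
    (hcpt : ∀ i, IsCompact (S i))
    (hcvx : ∀ i, Convex ℝ (S i))
    (Ψ : ∀ _ : ι, (∀ j, Fin (n j) → ℝ) → ℝ)
    (hcont : ∀ i, Continuous (Ψ i))
    (hconc : ∀ i (s : ∀ j, Fin (n j) → ℝ), (∀ j, s j ∈ S j) →
      ConcaveOn ℝ (S i) (fun x => Ψ i (Function.update s i x))) :
    ∃ s : ∀ j, Fin (n j) → ℝ, (∀ j, s j ∈ S j) ∧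
      ∀ i, ∀ x ∈ S i, Ψ i (Function.update s i x) ≤ Ψ i s := by
  let K : Set (∀ j, Fin (n j) → ℝ) := Set.univ.pi S
  have hmem : ∀ s, s ∈ K ↔ ∀ j, s j ∈ S j := fun s => by simp [K]
  let φ : (∀ j, Fin (n j) → ℝ) → (∀ j, Fin (n j) → ℝ) → ℝ := fun s y =>
    ∑ i, (Ψ i (Function.update s i (y i)) - Ψ i s)
  have hcontφ : ∀ y, Continuous fun s => φ s y := fun y =>
    continuous_finsetSum _ fun i _ =>
      ((hcont i).comp (continuous_id.update i continuous_const)).sub (hcont i)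
  have hconcφ : ∀ s ∈ K, ConcaveOn ℝ K (φ s) := by
    intro s hs
    refine ⟨convex_pi fun i _ => hcvx i, fun x hx y hy a b ha hb hab => ?_⟩
    simp only [φ, smul_eq_mul, Finset.mul_sum, ← Finset.sum_add_distrib]
    refine Finset.sum_le_sum fun i _ => ?_
    have := (hconc i s ((hmem s).mp hs)).2 ((hmem x).mp hx i) ((hmem y).mp hy i) ha hb hab
    simp only [smul_eq_mul] at this
    simp only [Pi.add_apply, Pi.smul_apply]
    linear_combination this - Ψ i s * hab
  obtain ⟨s, hs, hmax⟩ := exists_forall_apply_nonpos (Set.univ_pi_nonempty_iff.mpr hne)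
    (isCompact_univ_pi hcpt) (convex_pi fun i _ => hcvx i)
    (fun y _ => (hcontφ y).continuousOn) hconcφ (fun s _ => by simp [φ])
  refine ⟨s, (hmem s).mp hs, fun i x hx => ?_⟩
  have h := hmax (Function.update s i x) ((hmem _).mpr fun j => by
    by_cases hj : j = i
    · subst hj
      simpa using hx
    · simpa [hj] using (hmem s).mp hs j)
  have hφ : φ s (Function.update s i x) = Ψ i (Function.update s i x) - Ψ i s := by
    simp only [φ]
    rw [Finset.sum_eq_single i]
    · simp
    · intro j _ hj
      simp [hj]
    · simp
  linarith
end

section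
/- There exists a pure Nash equilibrium ((v*_k)_{k∈K}, π*) of the electricity market game: for every k ∈ K, v*_k ∈ S_k and Ψ_k(v, π*) ≤ Ψ_k(v*_k, π*) for all v ∈ S_k, and π* ∈ S_M with Ψ_M(π, (v*_k)) ≤ Ψ_M(π*, (v*_k)) for all π ∈ S_M. -/
open Matrix

/-- The quadratic form of a (not necessarily symmetric) matrix is convex as soon as it is
nonnegative. -/
theorem convexOn_dotProduct_mulVec_self {n : Type*} [Fintype n] {Q : Matrix n n ℝ}
    (hQ : ∀ x : n → ℝ, 0 ≤ x ⬝ᵥ (Q *ᵥ x)) :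
    ConvexOn ℝ Set.univ (fun x : n → ℝ => x ⬝ᵥ (Q *ᵥ x)) := by
  refine ⟨convex_univ, fun x _ y _ s t hs ht hst => ?_⟩
  obtain rfl : t = 1 - s := by linarith
  have h := mul_nonneg (mul_nonneg hs ht) (hQ (x - y))
  simp only [mulVec_add, mulVec_sub, mulVec_smul, dotProduct_add, add_dotProduct, dotProduct_sub,
    sub_dotProduct, dotProduct_smul, smul_dotProduct, smul_eq_mul] at h ⊢
  linarith

/-- A polyhedron given by linear equations and inequalities is convex. -/
theorem convex_setOf_mulVec_eq_and_mulVec_le {l m n : Type*} [Fintype n] (A : Matrix l n ℝ)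
    (a : l → ℝ) (B : Matrix m n ℝ) (b : m → ℝ) :
    Convex ℝ {v : n → ℝ | A *ᵥ v = a ∧ B *ᵥ v ≤ b} :=
  ((convex_singleton a).linear_preimage A.mulVecLin).inter
    ((convex_Iic b).linear_preimage B.mulVecLin)

/-- A polyhedron given by linear equations and inequalities is closed. -/
theorem isClosed_setOf_mulVec_eq_and_mulVec_le {l m n : Type*} [Fintype n] (A : Matrix l n ℝ)
    (a : l → ℝ) (B : Matrix m n ℝ) (b : m → ℝ) :
    IsClosed {v : n → ℝ | A *ᵥ v = a ∧ B *ᵥ v ≤ b} :=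
  (isClosed_eq (f := fun v => A *ᵥ v) (by fun_prop) continuous_const).inter
    (isClosed_le (f := fun v => B *ᵥ v) (by fun_prop) continuous_const)

/-- A game in which finitely many players `k` pay a cost `c k v π` that is continuous, convex in
their own compactly constrained strategy `v` and affine in the parameter `π`, while an opponent
chooses `π` to maximize the total cost, has an equilibrium. -/
theorem exists_equilibrium_of_convexOn_of_concaveOn {K F : Type*} [Fintype K] {E : K → Type*}
    [∀ k, AddCommGroup (E k)] [∀ k, Module ℝ (E k)] [∀ k, TopologicalSpace (E k)]
    [∀ k, IsTopologicalAddGroup (E k)] [∀ k, ContinuousSMul ℝ (E k)]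
    [AddCommGroup F] [Module ℝ F] [TopologicalSpace F] [IsTopologicalAddGroup F]
    [ContinuousSMul ℝ F] {S : ∀ k, Set (E k)} {T : Set F}
    (hSne : ∀ k, (S k).Nonempty) (hSconv : ∀ k, Convex ℝ (S k)) (hScomp : ∀ k, IsCompact (S k))
    (hTne : T.Nonempty) (hTconv : Convex ℝ T) (hTcomp : IsCompact T)
    {c : ∀ k, E k → F → ℝ}
    (hcont_left : ∀ k π, Continuous fun v => c k v π)
    (hcont_right : ∀ k v, Continuous (c k v))
    (hconv : ∀ k, ∀ π ∈ T, ConvexOn ℝ (S k) fun v => c k v π)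
    (hconc : ∀ k, ∀ v ∈ S k, ConcaveOn ℝ T (c k v)) :
    ∃ (vs : ∀ k, E k) (πs : F), (∀ k, vs k ∈ S k ∧ ∀ v ∈ S k, c k (vs k) πs ≤ c k v πs) ∧
      πs ∈ T ∧ ∀ π ∈ T, ∑ k, c k (vs k) π ≤ ∑ k, c k (vs k) πs := by
  classical
  have hX : Convex ℝ (Set.univ.pi S) := convex_pi fun k _ => hSconv k
  obtain ⟨vs, hvs, πs, hπs, hsaddle⟩ := Sion.exists_isSaddlePointOn
    (X := Set.univ.pi S) (Y := T) (f := fun v π => ∑ k, c k (v k) π)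
    (Set.univ_pi_nonempty_iff.2 hSne) hX (isCompact_univ_pi hScomp)
    (fun π _ => (continuous_finsetSum _ fun k _ =>
      (hcont_left k π).comp (continuous_apply k)).lowerSemicontinuous.lowerSemicontinuousOn _)
    (fun π hπ => ConvexOn.quasiconvexOn ⟨hX, fun x hx y hy s t hs ht hst => by
      simp only [Finset.smul_sum, ← Finset.sum_add_distrib]
      exact Finset.sum_le_sum fun k _ => (hconv k π hπ).2 (hx k trivial) (hy k trivial) hs ht hst⟩)
    hTconv hTne hTcomp
    (fun v _ => (continuous_finsetSum _ fun k _ =>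
      hcont_right k (v k)).upperSemicontinuous.upperSemicontinuousOn _)
    (fun v hv => ConcaveOn.quasiconcaveOn ⟨hTconv, fun x hx y hy s t hs ht hst => by
      simp only [Finset.smul_sum, ← Finset.sum_add_distrib]
      exact Finset.sum_le_sum fun k _ => (hconc k (v k) (hv k trivial)).2 hx hy hs ht hst⟩)
  refine ⟨vs, πs, fun k => ⟨hvs k trivial, fun v hv => ?_⟩, hπs, fun π hπ => hsaddle vs hvs π hπ⟩
  have hmem : Function.update vs k v ∈ Set.univ.pi S := by
    intro j _
    rcases eq_or_ne j k with rfl | hj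
    · simpa using hv
    · simpa [hj] using hvs j trivial
  have hrest : ∑ j ∈ Finset.univ.erase k, c j (Function.update vs k v j) πs =
      ∑ j ∈ Finset.univ.erase k, c j (vs j) πs :=
    Finset.sum_congr rfl fun j hj => by rw [Function.update_of_ne (Finset.ne_of_mem_erase hj)]
  have h : ∑ j, c j (vs j) πs ≤ ∑ j, c j (Function.update vs k v j) πs := hsaddle _ hmem πs hπs
  rw [← Finset.add_sum_erase _ _ (Finset.mem_univ k),
    ← Finset.add_sum_erase _ (fun j => c j (Function.update vs k v j) πs) (Finset.mem_univ k),
    hrest] at h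
  rw [Function.update_self] at h
  exact le_of_add_le_add_right h

/-- Existence of a pure Nash equilibrium of the electricity market game:
each participant `k` maximizes a mean-variance utility over a nonempty bounded
polyhedral feasible set `S k`, and the hypothetical market agent maximizes a
linear utility over the price box `SM`. -/
theorem electricity_market_nash_equilibrium_exists
    (N : ℕ) (K : Type*) [Fintype K]
    (d e f : K → ℕ)
    (A : ∀ k, Matrix (Fin (e k)) (Fin (d k)) ℝ) (a : ∀ k, Fin (e k) → ℝ)
    (B : ∀ k, Matrix (Fin (f k)) (Fin (d k)) ℝ) (b : ∀ k, Fin (f k) → ℝ)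
    (U : ∀ k, Matrix (Fin N) (Fin (d k)) ℝ) (g : ∀ k, Fin (d k) → ℝ)
    (lam : K → ℝ) (hlam : ∀ k, 0 < lam k)
    (Q : ∀ k, Matrix (Fin (d k)) (Fin (d k)) ℝ)
    (hQsymm : ∀ k, (Q k).IsSymm)
    (hQpsd : ∀ k (x : Fin (d k) → ℝ), 0 ≤ x ⬝ᵥ (Q k *ᵥ x))
    (Pmax : ℝ) (hPmax : 0 < Pmax)
    (S : ∀ k, Set (Fin (d k) → ℝ))
    (hS : ∀ k, S k = {v | A k *ᵥ v = a k ∧ B k *ᵥ v ≤ b k})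
    (hSne : ∀ k, (S k).Nonempty)
    (hSbdd : ∀ k, Bornology.IsBounded (S k))
    (SM : Set (Fin N → ℝ))
    (hSM : SM = {π | ∀ i, |π i| ≤ Pmax})
    (Ψ : ∀ k, (Fin (d k) → ℝ) → (Fin N → ℝ) → ℝ)
    (hΨ : ∀ k v π, Ψ k v π =
      -(((U k)ᵀ *ᵥ π + g k) ⬝ᵥ v) - lam k / 2 * (v ⬝ᵥ (Q k *ᵥ v)))
    (ΨM : (Fin N → ℝ) → (∀ k, Fin (d k) → ℝ) → ℝ)
    (hΨM : ∀ π v, ΨM π v = π ⬝ᵥ (∑ k, U k *ᵥ v k)) :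
    ∃ (vs : ∀ k, Fin (d k) → ℝ) (πs : Fin N → ℝ),
      (∀ k, vs k ∈ S k ∧ ∀ v ∈ S k, Ψ k v πs ≤ Ψ k (vs k) πs) ∧
      πs ∈ SM ∧ ∀ π ∈ SM, ΨM π vs ≤ ΨM πs vs := by
  have hbox : SM = Set.Icc (fun _ => -Pmax) (fun _ => Pmax) := by
    ext π
    simp [hSM, abs_le, Pi.le_def, forall_and]
  have hcost : ∀ k v π, -Ψ k v π =
      π ⬝ᵥ (U k *ᵥ v) + (g k ⬝ᵥ v + lam k / 2 * (v ⬝ᵥ (Q k *ᵥ v))) := fun k v π => by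
    rw [hΨ, add_dotProduct, mulVec_transpose, ← dotProduct_mulVec]
    ring
  have hSconv : ∀ k, Convex ℝ (S k) := fun k => by
    rw [hS]
    exact convex_setOf_mulVec_eq_and_mulVec_le _ _ _ _
  have hSclosed : ∀ k, IsClosed (S k) := fun k => by
    rw [hS]
    exact isClosed_setOf_mulVec_eq_and_mulVec_le _ _ _ _
  have hSMconv : Convex ℝ SM := hbox ▸ convex_Icc _ _
  obtain ⟨vs, πs, hvs, hπs, hmax⟩ := exists_equilibrium_of_convexOn_of_concaveOn
    (c := fun k v π => -Ψ k v π) hSne hSconv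
    (fun k => Metric.isCompact_of_isClosed_isBounded (hSclosed k) (hSbdd k))
    ⟨0, by simp [hSM, hPmax.le]⟩ hSMconv (hbox ▸ isCompact_Icc)
    (fun k π => by simp only [hcost]; fun_prop)
    (fun k v => by simp only [hcost]; fun_prop)
    (fun k π _ => by
      simp only [hcost]
      refine ConvexOn.add ⟨hSconv k, fun x _ y _ s t _ _ _ => ?_⟩
        (ConvexOn.add ⟨hSconv k, fun x _ y _ s t _ _ _ => ?_⟩
          (((convexOn_dotProduct_mulVec_self (hQpsd k)).subset (Set.subset_univ _)
            (hSconv k)).smul (half_pos (hlam k)).le))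
      · simp [mulVec_add, mulVec_smul]
      · simp)
    (fun k v _ => by
      simp only [hcost]
      exact ⟨hSMconv, fun x _ y _ s t _ _ hst => by
        simp only [add_dotProduct, smul_dotProduct, smul_eq_mul]
        obtain rfl : t = 1 - s := by linarith
        linarith⟩)
  refine ⟨vs, πs, fun k => ⟨(hvs k).1, fun v hv => neg_le_neg_iff.1 ((hvs k).2 v hv)⟩, hπs,
    fun π hπ => ?_⟩
  have h := hmax π hπ
  simp only [hcost, Finset.sum_add_distrib] at h
  simp only [hΨM, dotProduct_sum]
  linarith
end

section
/- Let Q be an N×N real symmetric positive definite matrix, let A be an m×N real matrix of full row rank (rank A = m), and set M := Q⁻¹ − Q⁻¹ A^⊤ (A Q⁻¹ A^⊤)⁻¹ A Q⁻¹. Then for every x ∈ ℝ^N, x^⊤ M x = 0 if and only if x lies in the range of A^⊤, i.e. there exists y ∈ ℝᵐ with x = A^⊤ y. -/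
open Matrix

/-- A matrix of full row rank has injective left multiplication. -/
lemma vecMul_injective_of_rank_eq {m N : ℕ} {A : Matrix (Fin m) (Fin N) ℝ} (hA : A.rank = m) :
    Function.Injective A.vecMul := by
  rw [vecMul_injective_iff, linearIndependent_iff_card_eq_finrank_span, Fintype.card_fin,
    Set.finrank, ← rank_eq_finrank_span_row, hA]

/-- For `Q` symmetric positive definite, `A` of full row rank, and
`M = Q⁻¹ − Q⁻¹ Aᵀ (A Q⁻¹ Aᵀ)⁻¹ A Q⁻¹`, the quadratic form of `M` vanishes at
`x` if and only if `x` is in the range of `Aᵀ`. -/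
theorem sensitivity_null_directions_iff_range
    {N m : ℕ} (Q : Matrix (Fin N) (Fin N) ℝ)
    (hQsymm : Q.IsSymm)
    (hQpd : ∀ x : Fin N → ℝ, x ≠ 0 → 0 < x ⬝ᵥ (Q *ᵥ x))
    (A : Matrix (Fin m) (Fin N) ℝ) (hA : A.rank = m)
    (M : Matrix (Fin N) (Fin N) ℝ)
    (hM : M = Q⁻¹ - Q⁻¹ * Aᵀ * (A * Q⁻¹ * Aᵀ)⁻¹ * A * Q⁻¹) :
    ∀ x : Fin N → ℝ,
      x ⬝ᵥ (M *ᵥ x) = 0 ↔ ∃ y : Fin m → ℝ, x = Aᵀ *ᵥ y := by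
  have hQ : Q.PosDef := .of_dotProduct_mulVec_pos
    (by simpa [IsHermitian, IsSymm] using hQsymm) (fun {x} hx => by simpa using hQpd x hx)
  have hS : (A * Q⁻¹ * Aᵀ).PosDef := by
    simpa using hQ.inv.mul_mul_conjTranspose_same (vecMul_injective_of_rank_eq hA)
  have hQdet : IsUnit Q.det := (isUnit_iff_isUnit_det _).1 hQ.isUnit
  have hSdet := (isUnit_iff_isUnit_det _).1 hS.isUnit
  have hMA : M * Aᵀ = 0 := by
    have h : Q⁻¹ * Aᵀ * (A * Q⁻¹ * Aᵀ)⁻¹ * A * Q⁻¹ * Aᵀ =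
        Q⁻¹ * Aᵀ * ((A * Q⁻¹ * Aᵀ)⁻¹ * (A * Q⁻¹ * Aᵀ)) := by
      simp only [Matrix.mul_assoc]
    rw [hM, Matrix.sub_mul, h, nonsing_inv_mul _ hSdet, Matrix.mul_one, sub_self]
  have hMsymm : Mᵀ = M := by
    rw [hM]
    simp only [transpose_sub, transpose_mul, transpose_nonsing_inv, transpose_transpose,
      hQsymm.eq, Matrix.mul_assoc]
  have hQM : Q * M = 1 - Aᵀ * ((A * Q⁻¹ * Aᵀ)⁻¹ * A * Q⁻¹) := by
    rw [hM, Matrix.mul_sub, mul_nonsing_inv _ hQdet]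
    simp only [Matrix.mul_assoc, mul_nonsing_inv_cancel_left _ _ hQdet]
  have hMQM : M * (Q * M) = M := by
    rw [hQM, Matrix.mul_sub, ← Matrix.mul_assoc M, hMA, Matrix.zero_mul, Matrix.mul_one, sub_zero]
  intro x
  constructor
  · intro hx
    have hMx : M *ᵥ x = 0 := by
      by_contra hne
      have hpos := hQpd _ hne
      rw [mulVec_mulVec, ← hMsymm, mulVec_transpose, ← dotProduct_mulVec, hMsymm,
        mulVec_mulVec, hMQM, hx] at hpos
      exact lt_irrefl _ hpos
    refine ⟨((A * Q⁻¹ * Aᵀ)⁻¹ * A * Q⁻¹) *ᵥ x, ?_⟩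
    have h : (Q * M) *ᵥ x = 0 := by rw [← mulVec_mulVec, hMx, mulVec_zero]
    rw [hQM, sub_mulVec, one_mulVec, ← mulVec_mulVec] at h
    exact sub_eq_zero.1 h
  · rintro ⟨y, rfl⟩
    rw [mulVec_mulVec, hMA, zero_mulVec, dotProduct_zero]
end
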